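/- arXiv:2512.18994 — 2 statements merged into one kernel-verified Lean document; each statement's English description precedes it below -/
import Mathlib

section
/- Let E be a real inner product space, I a finite index set with N = |I| ≥ 2 elements, x̂ : I → E with ‖x̂ i‖ = 1 for every i ∈ I, and p : I → ℝ. Let p̄ = (1/N) ∑_{i∈I} p i, μ = (1/N) ∑_{i∈I} x̂ i, α = N(1 − p̄), and let σ ≥ 0 satisfy σ² = (1/(N−1)) ∑_{i∈I} (p i − p̄)². Then ‖∑_{i∈I} (1 − p i) · x̂ i − α · μ‖ ≤ N · √(N−1) · σ. -/
/-- quantitative Proposition 1.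
The sum of per-sample gradients `∑ (1 - p i) • x i` deviates from `α • μ` by
at most `N √(N-1) σ`, where `σ` is the sample standard deviation of the
predicted probabilities. -/
theorem prototype_alignment_stddev_bound
    {E : Type*} [NormedAddCommGroup E] [InnerProductSpace ℝ E]
    {ι : Type*} [Fintype ι] [Nonempty ι] (hcard : 2 ≤ Fintype.card ι)
    (x : ι → E) (hx : ∀ i, ‖x i‖ = 1) (p : ι → ℝ)
    (N : ℝ) (hN : N = (Fintype.card ι : ℝ))
    (pbar : ℝ) (hpbar : pbar = (1 / N) * ∑ i, p i)
    (μ : E) (hμ : μ = (1 / N) • ∑ i, x i)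
    (α : ℝ) (hα : α = N * (1 - pbar))
    (σ : ℝ) (hσ : 0 ≤ σ)
    (hσ2 : σ ^ 2 = (1 / (N - 1)) * ∑ i, (p i - pbar) ^ 2) :
    ‖(∑ i, (1 - p i) • x i) - α • μ‖ ≤ N * Real.sqrt (N - 1) * σ := by
  have hN2 : (2:ℝ) ≤ N := by rw [hN]; exact_mod_cast hcard
  have hsum : ∑ i, (p i - pbar) ^ 2 = (N - 1) * σ ^ 2 := by
    have h1 : N - 1 ≠ 0 := by linarith
    rw [hσ2]; field_simp
  have hb : ∀ i, |p i - pbar| ≤ Real.sqrt (N - 1) * σ := by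
    intro i
    refine abs_le_of_sq_le_sq ?_ (by positivity)
    rw [mul_pow, Real.sq_sqrt (by linarith), ← hsum]
    exact Finset.single_le_sum (f := fun i => (p i - pbar) ^ 2)
      (fun j _ => sq_nonneg _) (Finset.mem_univ i)
  have hαμ : α • μ = ∑ i, (1 - pbar) • x i := by
    have h0 : N ≠ 0 := by linarith
    rw [hα, hμ, smul_smul, ← Finset.smul_sum]
    congr 1
    field_simp
  have heq : (∑ i, (1 - p i) • x i) - α • μ = ∑ i, (pbar - p i) • x i := by
    rw [hαμ, ← Finset.sum_sub_distrib]
    refine Finset.sum_congr rfl fun i _ => ?_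
    rw [← sub_smul]
    congr 1
    ring
  rw [heq]
  calc ‖∑ i, (pbar - p i) • x i‖ ≤ ∑ i, ‖(pbar - p i) • x i‖ := norm_sum_le _ _
    _ ≤ ∑ _i : ι, Real.sqrt (N - 1) * σ := by
        refine Finset.sum_le_sum fun i _ => ?_
        rw [norm_smul, hx i, mul_one, Real.norm_eq_abs, abs_sub_comm]
        exact hb i
    _ = N * Real.sqrt (N - 1) * σ := by
        rw [Finset.sum_const, Finset.card_univ, nsmul_eq_mul, ← hN, mul_assoc]
end

section
/- Let E be a real inner product space, C a finite nonempty class set with margins m : C → ℝ, c ∈ C, and I_H a finite index set of head-class samples. For each i ∈ I_H let x̂ i ∈ E with ‖x̂ i‖ = 1, let y i ∈ C with y i ≠ c, let z i : C → ℝ be the logits of sample i, and let p i(c) = exp(z i(c) − m(c)) / ∑_{k∈C} exp(z i(k) − m(k)). If z i(c) ≤ z i(y i) for every i ∈ I_H, then ‖∑_{i∈I_H} p i(c) · x̂ i‖ ≤ ∑_{i∈I_H} exp(m(y i) − m(c)). -/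
/-- Proposition 2 aggregated over head-class samples.
The total deviating influence `∑ p i c • x i` of head-class samples on the
tail-class prototype of class `c` is bounded by the sum of exponential terms
decaying in the margin gaps. -/
theorem head_influence_on_tail_prototype_bound
    {E : Type*} [NormedAddCommGroup E] [InnerProductSpace ℝ E]
    {C : Type*} [Fintype C] [Nonempty C]
    (m : C → ℝ) (c : C)
    {ιH : Type*} [Fintype ιH]
    (x : ιH → E) (hx : ∀ i, ‖x i‖ = 1)
    (y : ιH → C) (hy : ∀ i, y i ≠ c)
    (z : ιH → C → ℝ)
    (p : ιH → C → ℝ)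
    (hp : ∀ i k, p i k = Real.exp (z i k - m k) / ∑ j, Real.exp (z i j - m j))
    (hz : ∀ i, z i c ≤ z i (y i)) :
    ‖∑ i, p i c • x i‖ ≤ ∑ i, Real.exp (m (y i) - m c) := by
  refine norm_sum_le_of_le _ fun i _ => ?_
  have hS : Real.exp (z i (y i) - m (y i)) ≤ ∑ j, Real.exp (z i j - m j) :=
    Finset.single_le_sum (f := fun j => Real.exp (z i j - m j))
      (fun j _ => (Real.exp_pos _).le) (Finset.mem_univ (y i))
  have hpos : 0 < ∑ j, Real.exp (z i j - m j) := lt_of_lt_of_le (Real.exp_pos _) hS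
  have hp0 : 0 ≤ p i c := by
    rw [hp]
    exact div_nonneg (Real.exp_pos _).le hpos.le
  rw [norm_smul, hx, mul_one, Real.norm_of_nonneg hp0, hp, div_le_iff₀ hpos]
  calc Real.exp (z i c - m c)
      ≤ Real.exp (m (y i) - m c) * Real.exp (z i (y i) - m (y i)) := by
        rw [← Real.exp_add]
        exact Real.exp_le_exp.mpr (by linarith [hz i])
    _ ≤ _ := mul_le_mul_of_nonneg_left hS (Real.exp_pos _).le
end
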